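/- Let F be a finite nonempty tree and let o be any vertex of F. Then M_F(F) ≤ 2·M(F, o), where M_F(F) is the maximum over all vertices v of the cardinality of the orbit of v under Aut(F), and M(F, o) is the maximum over all vertices v of the cardinality of the orbit of v under the stabilizer subgroup Stab(o) = {g ∈ Aut(F) : g(o) = o}. -/

import Mathlib

/-- The automorphism group of a simple graph, as a subgroup of the
permutation group of the vertex set. -/
def graphAut {V : Type*} (G : SimpleGraph V) : Subgroup (Equiv.Perm V) where
  carrier := {f | ∀ u v, G.Adj (f u) (f v) ↔ G.Adj u v}
  one_mem' := by intro u v; simp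
  mul_mem' := by
    intro a b ha hb u v
    simp only [Set.mem_setOf_eq] at *
    rw [Equiv.Perm.mul_apply, Equiv.Perm.mul_apply, ha, hb]
  inv_mem' := by
    intro a ha u v
    simpa using (ha (a⁻¹ u) (a⁻¹ v)).symm

/-- The free (leaf) multiplicity of a graph: the maximum orbit size under
the full automorphism group. -/
noncomputable def freeLeafMult {V : Type*} (G : SimpleGraph V) : ℕ :=
  sSup (Set.range fun v : V => Nat.card (MulAction.orbit (graphAut G) v))

/-- The automorphic (leaf) multiplicity of the graph rooted at `o`: the
maximum orbit size under the stabilizer of `o` in the automorphism group. -/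
noncomputable def autLeafMult {V : Type*} (G : SimpleGraph V) (o : V) : ℕ :=
  sSup (Set.range fun v : V =>
    Nat.card (MulAction.orbit (MulAction.stabilizer (graphAut G) o) v))

namespace SimpleGraph

variable {V : Type*} {G : SimpleGraph V}

lemma Connected.dist_map_le (hG : G.Connected) {f : V → V}
    (hf : ∀ u v, G.Adj u v → G.Adj (f u) (f v)) (u v : V) : G.dist (f u) (f v) ≤ G.dist u v := by
  obtain ⟨p, hp⟩ := hG.exists_walk_length_eq_dist u v
  let φ : G →g G := ⟨f, fun h ↦ hf _ _ h⟩
  have := dist_le (p.map φ)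
  rwa [Walk.length_map, hp] at this

lemma Connected.dist_graphAut (hG : G.Connected) {g : Equiv.Perm V} (hg : g ∈ graphAut G)
    (u v : V) : G.dist (g u) (g v) = G.dist u v := by
  refine le_antisymm (hG.dist_map_le (fun u v h ↦ (hg u v).2 h) u v) ?_
  have h := hG.dist_map_le (fun u v h ↦ ((inv_mem hg : g⁻¹ ∈ graphAut G) u v).2 h) (g u) (g v)
  simpa using h

lemma Connected.exists_adj_dist_lt (hG : G.Connected) {p t : V} (h : p ≠ t) :
    ∃ q, G.Adj p q ∧ G.dist t q < G.dist t p := by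
  obtain ⟨w, hw⟩ := hG.exists_walk_length_eq_dist p t
  cases w with
  | nil => exact absurd rfl h
  | @cons _ q _ hadj w =>
    refine ⟨q, hadj, ?_⟩
    rw [dist_comm, G.dist_comm (u := t), ← hw, Walk.length_cons]
    exact Nat.lt_succ_of_le (dist_le w)

lemma IsTree.eq_of_adj_of_dist_lt (hG : G.IsTree) {t x y z : V} (hy : G.Adj x y) (hz : G.Adj x z)
    (hty : G.dist t y < G.dist t x) (htz : G.dist t z < G.dist t x) : y = z := by
  have key : ∀ w, G.Adj x w → G.dist t w < G.dist t x →
      ∃ p : G.Walk t x, p.IsPath ∧ p.penultimate = w := by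
    intro w hw hlt
    obtain ⟨p, hp⟩ := hG.connected.exists_walk_length_eq_dist t w
    refine ⟨p.concat hw.symm, Walk.isPath_of_length_eq_dist _ ?_, by simp⟩
    rw [Walk.length_concat, hp]
    have := hG.dist_eq_dist_add_one_of_adj t hw
    omega
  obtain ⟨p, hp, rfl⟩ := key y hy hty
  obtain ⟨q, hq, rfl⟩ := key z hz htz
  rw [(hG.existsUnique_path t x).unique hp hq]

/-- The vertices closer to `q` than to `p`; for an edge `pq` of a tree, this is the component
of `q` after deleting that edge. -/
def halfTree (G : SimpleGraph V) (p q : V) : Set V := {t | G.dist t q < G.dist t p}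

lemma mem_halfTree {p q t : V} : t ∈ G.halfTree p q ↔ G.dist t q < G.dist t p := Iff.rfl

lemma left_notMem_halfTree (p q : V) : p ∉ G.halfTree p q := by
  simp [mem_halfTree]

lemma Adj.right_mem_halfTree {p q : V} (h : G.Adj p q) : q ∈ G.halfTree p q := by
  simp [mem_halfTree, dist_eq_one_iff_adj.2 h.symm]

lemma IsTree.notMem_halfTree_iff (hG : G.IsTree) {p q t : V} (h : G.Adj p q) :
    t ∉ G.halfTree p q ↔ t ∈ G.halfTree q p := by
  have := hG.dist_eq_dist_add_one_of_adj t h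
  simp only [mem_halfTree]
  omega

lemma Connected.apply_mem_halfTree_iff (hG : G.Connected) {g : Equiv.Perm V}
    (hg : g ∈ graphAut G) {p q t : V} :
    g t ∈ G.halfTree (g p) (g q) ↔ t ∈ G.halfTree p q := by
  simp only [mem_halfTree, hG.dist_graphAut hg]

lemma IsTree.eq_of_mem_halfTree (hG : G.IsTree) {p q r t : V} (hq : G.Adj p q) (hr : G.Adj p r)
    (htq : t ∈ G.halfTree p q) (htr : t ∈ G.halfTree p r) : q = r :=
  hG.eq_of_adj_of_dist_lt hq hr htq htr

/-- The only edge leaving a half-tree is the edge that defines it. -/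
lemma IsTree.eq_of_adj_of_mem_halfTree (hG : G.IsTree) {p q u v : V} (hpq : G.Adj p q)
    (huv : G.Adj u v) (hu : u ∈ G.halfTree p q) (hv : v ∉ G.halfTree p q) : u = q ∧ v = p := by
  have hv' := (hG.notMem_halfTree_iff hpq).1 hv
  rw [mem_halfTree] at hu hv'
  have h1 := hG.dist_eq_dist_add_one_of_adj u hpq
  have h2 := hG.dist_eq_dist_add_one_of_adj v hpq
  have h3 := hG.dist_eq_dist_add_one_of_adj p huv
  have h4 := hG.dist_eq_dist_add_one_of_adj q huv
  simp only [G.dist_comm (u := p), G.dist_comm (u := q)] at h3 h4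
  suffices h0 : v = p by
    subst h0
    rw [dist_self] at h3
    exact ⟨(hG.connected.dist_eq_zero_iff).1 (by omega), rfl⟩
  by_contra hvp
  obtain ⟨w, hw, hlt⟩ := hG.connected.exists_adj_dist_lt (p := v) (t := p) hvp
  have h5 := hG.connected.dist_triangle (u := q) (v := p) (w := w)
  rw [dist_eq_one_iff_adj.2 hpq.symm] at h5
  simp only [G.dist_comm (u := p)] at hlt h5
  have h6 : w = u := hG.eq_of_adj_of_dist_lt (t := q) hw huv.symm
    (by rw [G.dist_comm (u := q) (v := v)]; omega)
    (by rw [G.dist_comm (u := q) (v := v), G.dist_comm (u := q) (v := u)]; omega)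
  subst h6
  omega

lemma IsTree.mem_halfTree_iff_of_adj (hG : G.IsTree) {p q u v : V} (hpq : G.Adj p q)
    (huv : G.Adj u v) (hu : u ≠ p) (hv : v ≠ p) :
    u ∈ G.halfTree p q ↔ v ∈ G.halfTree p q := by
  constructor
  · intro h
    by_contra h'
    exact hv (hG.eq_of_adj_of_mem_halfTree hpq huv h h').2
  · intro h
    by_contra h'
    exact hu (hG.eq_of_adj_of_mem_halfTree hpq huv.symm h h').2

lemma IsTree.dist_eq_add_of_notMem_of_mem_halfTree (hG : G.IsTree) {p q s t : V}
    (hpq : G.Adj p q) (ht : t ∉ G.halfTree p q) (hs : s ∈ G.halfTree p q) :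
    G.dist s t = G.dist s p + G.dist p t := by
  classical
  obtain ⟨w, hw⟩ := hG.connected.exists_walk_length_eq_dist s t
  obtain ⟨d, hd, h1, h2⟩ := w.exists_boundary_dart _ hs ht
  have hp := (hG.eq_of_adj_of_mem_halfTree hpq d.adj h1 h2).2
  have hmem : p ∈ w.support := hp ▸ w.dart_snd_mem_support_of_mem_darts hd
  have h3 := congrArg Walk.length (w.take_spec hmem)
  rw [Walk.length_append] at h3
  have h4 := dist_le (w.takeUntil p hmem)
  have h5 := dist_le (w.dropUntil p hmem)
  have := hG.connected.dist_triangle (u := s) (v := p) (w := t)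
  omega

open Classical in
/-- Apply `g` on the branch `r` at `p`, apply `g⁻¹` on its image, and fix everything else. -/
noncomputable def branchSwap (G : SimpleGraph V) (g : Equiv.Perm V) (p r x : V) : V :=
  if x ∈ G.halfTree p r then g x else if x ∈ G.halfTree p (g r) then g⁻¹ x else x

lemma branchSwap_leftInverse (hG : G.IsTree) {g : Equiv.Perm V} (hg : g ∈ graphAut G) {p r : V}
    (hgp : g p = p) (hr : G.Adj p r) :
    Function.LeftInverse (G.branchSwap g⁻¹ p (g r)) (G.branchSwap g p r) := by
  intro x
  have hr' : G.Adj p (g r) := by have := (hg p r).2 hr; rwa [hgp] at this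
  have key : ∀ y, g y ∈ G.halfTree p (g r) ↔ y ∈ G.halfTree p r := by
    intro y
    have := hG.connected.apply_mem_halfTree_iff hg (p := p) (q := r) (t := y)
    rwa [hgp] at this
  have key' : ∀ y, g⁻¹ y ∈ G.halfTree p r ↔ y ∈ G.halfTree p (g r) := by
    intro y
    rw [← key]
    simp
  have huniq : ∀ y, y ∈ G.halfTree p r → y ∈ G.halfTree p (g r) → g r = r := fun y h h' ↦
    (hG.eq_of_mem_halfTree hr hr' h h').symm
  by_cases h1 : x ∈ G.halfTree p r
  · simp [branchSwap, h1, key]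
  by_cases h2 : x ∈ G.halfTree p (g r)
  · have h3 := (key' x).2 h2
    have h4 : g⁻¹ x ∉ G.halfTree p (g r) := by
      intro h4
      rw [huniq _ h3 h4] at h2
      exact h1 h2
    have h5 : G.branchSwap g p r x = g⁻¹ x := by rw [branchSwap, if_neg h1, if_pos h2]
    rw [h5, branchSwap, if_neg h4, g.inv_eq_iff_eq.2 rfl, if_pos h3, inv_inv]
    exact g.apply_symm_apply x
  · simp [branchSwap, h1, h2]

lemma branchSwap_adj (hG : G.IsTree) {g : Equiv.Perm V} (hg : g ∈ graphAut G) {p r : V}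
    (hgp : g p = p) (hr : G.Adj p r) {u v : V} (huv : G.Adj u v) :
    G.Adj (G.branchSwap g p r u) (G.branchSwap g p r v) := by
  have hr' : G.Adj p (g r) := by have := (hg p r).2 hr; rwa [hgp] at this
  have hgp' : g⁻¹ p = p := by rw [Equiv.Perm.inv_eq_iff_eq, hgp]
  have hg' : g⁻¹ ∈ graphAut G := inv_mem hg
  have hp : G.branchSwap g p r p = p := by simp [branchSwap, left_notMem_halfTree]
  have hadj : ∀ w, G.Adj p w → G.Adj p (G.branchSwap g p r w) := by
    intro w hw
    have h1 := (hg p w).2 hw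
    have h2 := (hg' p w).2 hw
    rw [hgp] at h1
    rw [hgp'] at h2
    unfold branchSwap
    split_ifs <;> assumption
  by_cases hu : u = p
  · subst hu
    rw [hp]
    exact hadj v huv
  by_cases hv : v = p
  · subst hv
    rw [hp]
    exact (hadj u huv.symm).symm
  have h1 := hG.mem_halfTree_iff_of_adj hr huv hu hv
  have h2 := hG.mem_halfTree_iff_of_adj hr' huv hu hv
  have h3 := (hg u v).2 huv
  have h4 := (hg' u v).2 huv
  unfold branchSwap
  split_ifs <;> first | assumption | (exfalso; tauto)

lemma exists_graphAut_of_mem_halfTree (hG : G.IsTree) {g : Equiv.Perm V}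
    (hg : g ∈ graphAut G) {o p r u : V} (hgp : g p = p) (hr : G.Adj p r)
    (ho : o ∉ G.halfTree p r) (ho' : o ∉ G.halfTree p (g r)) (hu : u ∈ G.halfTree p r) :
    ∃ h ∈ graphAut G, h o = o ∧ h u = g u := by
  have hr' : G.Adj p (g r) := by have := (hg p r).2 hr; rwa [hgp] at this
  have hgp' : g⁻¹ p = p := by rw [Equiv.Perm.inv_eq_iff_eq, hgp]
  have hg' : g⁻¹ ∈ graphAut G := inv_mem hg
  have hleft := branchSwap_leftInverse hG hg hgp hr
  have hright := branchSwap_leftInverse hG hg' hgp' hr'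
  rw [inv_inv, g.inv_eq_iff_eq.2 rfl] at hright
  refine ⟨⟨G.branchSwap g p r, G.branchSwap g⁻¹ p (g r), hleft, hright⟩, ?_, ?_, ?_⟩
  · intro x y
    refine ⟨fun h ↦ ?_, branchSwap_adj hG hg hgp hr⟩
    have := branchSwap_adj hG hg' hgp' hr' h
    simp only [Equiv.coe_fn_mk] at this
    rwa [hleft x, hleft y] at this
  · simp [branchSwap, ho, ho']
  · simp [branchSwap, hu]

variable [Fintype V]

/-- The sum of the distances from `x` to all vertices. -/
noncomputable def distSum (G : SimpleGraph V) (x : V) : ℕ := ∑ t, G.dist t x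

lemma Connected.distSum_graphAut (hG : G.Connected) {g : Equiv.Perm V} (hg : g ∈ graphAut G)
    (x : V) : G.distSum (g x) = G.distSum x := by
  unfold distSum
  rw [← Equiv.sum_comp g]
  exact Finset.sum_congr rfl fun t _ ↦ hG.dist_graphAut hg t x

/-- Two distinct medians of a tree are adjacent. -/
lemma IsTree.adj_of_forall_distSum_le (hG : G.IsTree) {p p' : V}
    (hp : ∀ x, G.distSum p ≤ G.distSum x) (hp' : ∀ x, G.distSum p' ≤ G.distSum x)
    (hne : p ≠ p') : G.Adj p p' := by
  by_contra hadj
  obtain ⟨y, hy, hlt⟩ := hG.connected.exists_adj_dist_lt hne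
  obtain ⟨z, hz, hlt'⟩ := hG.connected.exists_adj_dist_lt hne.symm
  have hyp : y ≠ p' := by rintro rfl; exact hadj hy
  have hcover : ∀ t, t ∉ G.halfTree p y → t ∈ G.halfTree p' z := by
    intro t ht
    have h1 := hG.dist_eq_add_of_notMem_of_mem_halfTree hy ht hlt
    have h2 := hG.connected.dist_triangle (u := z) (v := p) (w := t)
    rw [mem_halfTree, G.dist_comm (u := t) (v := z), G.dist_comm (u := t) (v := p')]
    rw [G.dist_comm (u := p) (v := z), G.dist_comm (u := p) (v := p')] at hlt'
    omega
  have hyz : y ∈ G.halfTree p' z := by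
    by_contra h
    exact hyp (hG.eq_of_adj_of_mem_halfTree hz hy hlt' h).2
  have hsum : G.distSum y + G.distSum z < G.distSum p + G.distSum p' := by
    unfold distSum
    rw [← Finset.sum_add_distrib, ← Finset.sum_add_distrib]
    refine Finset.sum_lt_sum (fun t _ ↦ ?_) ⟨y, Finset.mem_univ _, ?_⟩
    · have h1 := hG.dist_eq_dist_add_one_of_adj t hy
      have h2 := hG.dist_eq_dist_add_one_of_adj t hz
      have h3 := hcover t
      simp only [mem_halfTree] at h3
      omega
    · have h1 := hy.right_mem_halfTree
      rw [mem_halfTree] at h1 hyz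
      omega
  have := hp y
  have := hp' z
  omega

/-- Automorphisms of a finite tree have a common fixed vertex, or flip a common edge. -/
lemma IsTree.exists_fixed_or_flipped_edge (hG : G.IsTree) :
    (∃ p, ∀ g ∈ graphAut G, g p = p) ∨
      ∃ p q, G.Adj p q ∧ (∀ g ∈ graphAut G, g p = p ∧ g q = q ∨ g p = q ∧ g q = p) ∧
        ∃ g ∈ graphAut G, g p = q ∧ g q = p := by
  have := hG.connected.nonempty
  obtain ⟨p, -, hp⟩ := Finset.exists_min_image Finset.univ G.distSum Finset.univ_nonempty
  replace hp : ∀ x, G.distSum p ≤ G.distSum x := fun x ↦ hp x (Finset.mem_univ x)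
  by_cases hfix : ∀ g ∈ graphAut G, g p = p
  · exact Or.inl ⟨p, hfix⟩
  push Not at hfix
  obtain ⟨g, hg, hgp⟩ := hfix
  have hmin : ∀ h ∈ graphAut G, ∀ x, (∀ y, G.distSum x ≤ G.distSum y) →
      ∀ y, G.distSum (h x) ≤ G.distSum y := fun h hh x hx y ↦
    (hG.connected.distSum_graphAut hh x).trans_le (hx y)
  have hq := hmin g hg p hp
  have hpq := hG.adj_of_forall_distSum_le hp hq (Ne.symm hgp)
  have hmem : ∀ x, (∀ y, G.distSum x ≤ G.distSum y) → x = p ∨ x = g p := by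
    intro x hx
    by_contra! hne
    have h1 := hG.adj_of_forall_distSum_le hx hp hne.1
    have h2 := hG.adj_of_forall_distSum_le hx hq hne.2
    apply hG.dist_ne_of_adj x hpq
    rw [dist_eq_one_iff_adj.2 h1, dist_eq_one_iff_adj.2 h2]
  have hcases : ∀ h ∈ graphAut G, h p = p ∧ h (g p) = g p ∨ h p = g p ∧ h (g p) = p := by
    intro h hh
    have h1 := hmem _ (hmin h hh p hp)
    have h2 := hmem _ (hmin h hh _ hq)
    have h3 : h p ≠ h (g p) := fun e ↦ hgp (h.injective e).symm
    grind
  refine Or.inr ⟨p, g p, hpq, hcases, g, hg, rfl, ?_⟩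
  rcases hcases g hg with h | h
  · exact absurd h.1 hgp
  · exact h.2

/-- A vertex `o` that is moved by some automorphism of a finite tree lies in a set `S` with a
disjoint translate, such that off `S` every automorphism agrees pointwise with one fixing `o`. -/
lemma IsTree.exists_set_of_not_fixed (hG : G.IsTree) {o : V}
    (ho : ¬ ∀ g ∈ graphAut G, g o = o) :
    ∃ S : Set V, (∃ g ∈ graphAut G, ∀ x ∈ S, g x ∉ S) ∧
      ∀ g ∈ graphAut G, ∀ u ∉ S, g u ∉ S → ∃ h ∈ graphAut G, h o = o ∧ h u = g u := by
  classical
  rcases hG.exists_fixed_or_flipped_edge with hfix | ⟨p, q, hpq, hcases, g₀, hg₀, hgp, hgq⟩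
  · obtain ⟨p, hp, hmin⟩ := Finset.exists_min_image
      (Finset.univ.filter fun p ↦ ∀ g ∈ graphAut G, g p = p) (G.dist o)
      (by simpa [Finset.Nonempty] using hfix)
    simp only [Finset.mem_filter, Finset.mem_univ, true_and] at hp hmin
    have hpo : p ≠ o := by rintro rfl; exact ho hp
    obtain ⟨q, hpq, hlt⟩ := hG.connected.exists_adj_dist_lt hpo
    have hq : ∃ g ∈ graphAut G, g q ≠ q := by
      by_contra! h
      exact absurd (hmin q h) (not_le.2 hlt)
    obtain ⟨g₀, hg₀, hgq⟩ := hq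
    refine ⟨G.halfTree p q, ⟨g₀, hg₀, fun x hx hx' ↦ hgq ?_⟩, fun g hg u hu hgu ↦ ?_⟩
    · have h1 := (hG.connected.apply_mem_halfTree_iff hg₀).2 hx
      have h2 := (hg₀ p q).2 hpq
      rw [hp g₀ hg₀] at h1 h2
      exact hG.eq_of_mem_halfTree h2 hpq h1 hx'
    · by_cases hup : p = u
      · subst hup
        exact ⟨1, one_mem _, rfl, (hp g hg).symm⟩
      obtain ⟨r, hr, hur⟩ := hG.connected.exists_adj_dist_lt hup
      have h1 := (hG.connected.apply_mem_halfTree_iff hg (p := p) (q := r) (t := u)).2 hur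
      have h2 := (hg p r).2 hr
      rw [hp g hg] at h1 h2
      refine exists_graphAut_of_mem_halfTree hG hg (hp g hg) hr (fun h ↦ hu ?_)
        (fun h ↦ hgu ?_) hur
      · rwa [hG.eq_of_mem_halfTree hpq hr hlt h]
      · rwa [hG.eq_of_mem_halfTree hpq h2 hlt h]
  · wlog hoq : o ∈ G.halfTree p q generalizing p q
    · exact this q p hpq.symm (fun g hg ↦ by have := hcases g hg; tauto) hgq hgp
        ((hG.notMem_halfTree_iff hpq).1 hoq)
    have hoq' : o ∉ G.halfTree q p := (hG.notMem_halfTree_iff hpq.symm).2 hoq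
    refine ⟨G.halfTree p q, ⟨g₀, hg₀, fun x hx ↦ ?_⟩, fun g hg u hu hgu ↦ ?_⟩
    · have h1 := (hG.connected.apply_mem_halfTree_iff hg₀).2 hx
      rw [hgp, hgq] at h1
      exact (hG.notMem_halfTree_iff hpq).2 h1
    · have hu' := (hG.notMem_halfTree_iff hpq).1 hu
      rcases hcases g hg with ⟨h1, h2⟩ | ⟨h1, h2⟩
      · exact exists_graphAut_of_mem_halfTree hG hg h2 hpq.symm hoq' (by rwa [h1]) hu'
      · have h3 := (hG.connected.apply_mem_halfTree_iff hg).2 hu'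
        rw [h1, h2] at h3
        exact absurd h3 hgu

/-- Every orbit of automorphisms of a finite tree is at most twice as large as some orbit of
the stabilizer of a given vertex. -/
lemma IsTree.exists_card_orbit_le (hG : G.IsTree) (o v : V) :
    ∃ w : V, Nat.card (MulAction.orbit (graphAut G) v) ≤
      2 * Nat.card (MulAction.orbit (MulAction.stabilizer (graphAut G) o) w) := by
  have hmem : ∀ {h : Equiv.Perm V}, h ∈ graphAut G → h o = o → ∀ u : V,
      h u ∈ MulAction.orbit (MulAction.stabilizer (graphAut G) o) u :=
    fun {h} hh ho u ↦
      MulAction.mem_orbit u (⟨⟨h, hh⟩, ho⟩ : MulAction.stabilizer (graphAut G) o)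
  simp only [Nat.card_coe_set_eq]
  by_cases hfix : ∀ g ∈ graphAut G, g o = o
  · refine ⟨v, (Set.ncard_le_ncard ?_ (Set.toFinite _)).trans (Nat.le_mul_of_pos_left _ two_pos)⟩
    rintro _ ⟨⟨g, hg⟩, rfl⟩
    exact hmem hg (hfix g hg) v
  obtain ⟨S, ⟨g₀, hg₀, hS⟩, hswap⟩ := hG.exists_set_of_not_fixed hfix
  set O := MulAction.orbit (graphAut G) v with hO
  have hgO : ∀ g ∈ graphAut G, ∀ x ∈ O, g x ∈ O := fun g hg x hx ↦
    (MulAction.mem_orbit_of_mem_orbit (⟨g, hg⟩ : graphAut G) hx)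
  have hvO : v ∈ O := MulAction.mem_orbit_self v
  obtain ⟨w, hwO, hwS⟩ : ∃ w ∈ O, w ∉ S := by
    by_cases hv : v ∈ S
    · exact ⟨g₀ v, hgO g₀ hg₀ v hvO, hS v hv⟩
    · exact ⟨v, hvO, hv⟩
  refine ⟨w, ?_⟩
  have h1 : (O ∩ S).ncard ≤ (O \ S).ncard :=
    Set.ncard_le_ncard_of_injOn g₀ (fun x hx ↦ ⟨hgO g₀ hg₀ x hx.1, hS x hx.2⟩)
      g₀.injective.injOn (Set.toFinite _)
  have h2 : (O \ S).ncard ≤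
      (MulAction.orbit (MulAction.stabilizer (graphAut G) o) w).ncard := by
    refine Set.ncard_le_ncard ?_ (Set.toFinite _)
    rintro x ⟨hxO, hxS⟩
    rw [hO, ← MulAction.orbit_eq_iff.2 hwO] at hxO
    obtain ⟨⟨g, hg⟩, rfl⟩ := hxO
    obtain ⟨h, hh, hho, hhw⟩ := hswap g hg w hwS hxS
    have := hmem hh hho w
    rwa [hhw] at this
  have h3 := Set.ncard_inter_add_ncard_sdiff_eq_ncard O S (Set.toFinite _)
  omega

end SimpleGraph

/-- for a finite nonempty tree and any root `o`,
`M_F(F) ≤ 2 · M(F, o)`. -/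
theorem freeLeafMult_le_two_mul_autLeafMult {V : Type*} [Fintype V] [Nonempty V]
    (G : SimpleGraph V) (hconn : G.Connected) (hacyc : G.IsAcyclic) (o : V) :
    freeLeafMult G ≤ 2 * autLeafMult G o := by
  refine csSup_le (Set.range_nonempty _) ?_
  rintro _ ⟨v, rfl⟩
  obtain ⟨w, hw⟩ := SimpleGraph.IsTree.exists_card_orbit_le ⟨hconn, hacyc⟩ o v
  exact hw.trans (Nat.mul_le_mul_left 2
    (le_csSup (Set.finite_range _).bddAbove (Set.mem_range_self w)))
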